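/- arXiv:2603.08378 — 2 statements merged into one kernel-verified Lean document; each statement's English description precedes it below -/
import Mathlib

section
/- Let n be a positive integer and let η_{n+1} = (√((n+1)²+4) − (n+1))/2 be the fixed point [0; n+1, n+1, ...] of the Gauss map. Then the n-Brjuno function B_n attains its unique global minimum on (0,1) at η_{n+1}: for every irrational x ∈ (0,1), B_n(x) ≥ B_n(η_{n+1}), with equality if and only if x = η_{n+1}. -/
open Real Set MeasureTheory
open scoped ENNReal

/-- The Gauss map `A(x) = 1/x - ⌊1/x⌋`. -/
noncomputable def gaussMap (x : ℝ) : ℝ := 1 / x - (⌊1 / x⌋ : ℝ)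

/-- `brjunoBeta x j = β_{j-1}(x) = ∏_{i=0}^{j-1} A^i(x)`; in particular
`brjunoBeta x 0 = β_{-1}(x) = 1` and `β_K(x) = brjunoBeta x (K+1)`. -/
noncomputable def brjunoBeta (x : ℝ) (j : ℕ) : ℝ := ∏ i ∈ Finset.range j, gaussMap^[i] x

/-- The σ-Brjuno function `B_σ(x) = Σ_{j≥0} β_{j-1}(x) · (A^j x)^{-1/σ}`, valued in `[0,+∞]`. -/
noncomputable def brjuno (σ x : ℝ) : ℝ≥0∞ :=
  ∑' j : ℕ, ENNReal.ofReal (brjunoBeta x j * (gaussMap^[j] x) ^ (-(1 / σ)))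

/-- The K-th partial sum `B_σ^{(K)}(x) = Σ_{j=0}^{K} β_{j-1}(x) · (A^j x)^{-1/σ}`. -/
noncomputable def brjunoPartial (σ x : ℝ) (K : ℕ) : ℝ :=
  ∑ j ∈ Finset.range (K + 1), brjunoBeta x j * (gaussMap^[j] x) ^ (-(1 / σ))

/-- The fixed point `η_m = (√(m²+4) − m)/2 = [0; m, m, m, ...]` of the Gauss map. -/
noncomputable def eta (m : ℕ) : ℝ := (Real.sqrt ((m : ℝ) ^ 2 + 4) - m) / 2

/-- `b* = (σ+1)^{1+1/σ}/σ`. -/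
noncomputable def bstar (σ : ℝ) : ℝ := (σ + 1) ^ (1 + 1 / σ) / σ

/-- The global lower bound `g(x) = x^{-1/σ} + b*·x`. -/
noncomputable def gLow (σ x : ℝ) : ℝ := x ^ (-(1 / σ)) + bstar σ * x

/-- The cylinder lower bound `g_k(x) = x^{-1/σ} + x·(1/x − k)^{-1/σ} + (1 − kx)·b*`. -/
noncomputable def gCyl (σ : ℝ) (k : ℕ) (x : ℝ) : ℝ :=
  x ^ (-(1 / σ)) + x * (1 / x - (k : ℝ)) ^ (-(1 / σ)) + (1 - (k : ℝ) * x) * bstar σ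

theorem one_add_mul_one_sub_le_rpow_neg {a s : ℝ} (ha : 0 < a) (hs : 0 ≤ s) (hs1 : s ≤ 1) :
    1 + s * (1 - a) ≤ a ^ (-s) := by
  have h := rpow_one_add_le_one_add_mul_self (s := a - 1) (by linarith) hs hs1
  rw [add_sub_cancel] at h
  have hp : 0 < a ^ s := rpow_pos_of_pos ha s
  rw [rpow_neg ha.le, ← one_div, le_div_iff₀ hp]
  rcases le_or_gt (1 + s * (1 - a)) 0 with h0 | h0
  · nlinarith
  · nlinarith [mul_le_mul_of_nonneg_left h h0.le, sq_nonneg (s * (1 - a))]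

theorem bstar_pos {N : ℝ} (hN : 1 ≤ N) : 0 < bstar N := by
  unfold bstar; positivity

theorem bstar_mul_le_rpow {N u : ℝ} (hN : 1 ≤ N) (hu0 : 0 ≤ u) (hu : u < N + 1) :
    bstar N * (N - u + u ^ 2 / (N * (N + 1) ^ 2)) ≤ (N + 1 - u) ^ (1 + 1 / N) := by
  have hN0 : 0 < N := by linarith
  obtain ⟨v, rfl⟩ : ∃ v, u = (N + 1) * v := ⟨u / (N + 1), by field_simp⟩
  have hv0 : 0 ≤ v := by
    by_contra! h; nlinarith
  have hv1 : 0 < 1 - v := by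
    by_contra! h; nlinarith
  have hs1 : 1 / N ≤ 1 := by rw [div_le_one hN0]; exact hN
  have hB := rpow_one_add_le_one_add_mul_self (s := 1 / (1 - v) - 1)
    (by have : 0 < 1 / (1 - v) := by positivity
        linarith) (by positivity : 0 ≤ 1 / N) hs1
  rw [add_sub_cancel, one_div (1 - v), inv_rpow hv1.le] at hB
  have hp : 0 < (1 - v) ^ (1 / N) := rpow_pos_of_pos hv1 _
  have hD : 0 < N * (1 - v) + v := by positivity
  have hB' : N * (1 - v) / (N * (1 - v) + v) ≤ (1 - v) ^ (1 / N) := by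
    have : 1 + 1 / N * ((1 - v)⁻¹ - 1) = (N * (1 - v) / (N * (1 - v) + v))⁻¹ := by
      field_simp; ring
    rw [this] at hB
    exact (inv_le_inv₀ hp (by positivity)).1 hB
  have h1 : N + 1 - (N + 1) * v = (N + 1) * (1 - v) := by ring
  rw [h1, mul_rpow (by positivity) hv1.le, rpow_add hv1, rpow_one, bstar, div_mul_eq_mul_div,
    mul_div_assoc]
  gcongr
  refine le_trans ?_ (mul_le_mul_of_nonneg_left hB' hv1.le)
  rw [← mul_div_assoc, div_le_div_iff₀ hN0 hD]
  have h2 : (1 - v) * (N * (1 - v)) * N -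
      (N - (N + 1) * v + ((N + 1) * v) ^ 2 / (N * (N + 1) ^ 2)) * (N * (1 - v) + v) =
      v ^ 3 * (N - 1) / N := by
    field_simp; ring
  have h3 : 0 ≤ v ^ 3 * (N - 1) / N := by
    have : 0 ≤ N - 1 := by linarith
    positivity
  linarith

/-- The value of the Brjuno function of index `N` at a fixed point `e` of the Gauss map. -/
noncomputable def fixedValue (N e : ℝ) : ℝ := e ^ (-(1 / N)) / (1 - e)

theorem fixedValue_le {N e : ℝ} (hN : 1 ≤ N) (he0 : 0 < e) (he : e ^ 2 + (N + 1) * e = 1) :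
    fixedValue N e ≤ bstar N * (1 + e ^ 4 / ((1 - e ^ 2) * (N + e ^ 2))) := by
  have hN0 : 0 < N := by linarith
  have hw : 0 < 1 - e ^ 2 := by nlinarith
  have hs1 : 1 / N ≤ 1 := by rw [div_le_one hN0]; exact hN
  have hB := rpow_one_add_le_one_add_mul_self (s := 1 / (1 - e ^ 2) - 1)
    (by have : 0 < 1 / (1 - e ^ 2) := by positivity
        linarith) (by positivity : 0 ≤ 1 / N) hs1
  rw [add_sub_cancel, one_div (1 - e ^ 2), inv_rpow hw.le] at hB
  have h1 : e = (1 - e ^ 2) / (N + 1) := by field_simp; linarith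
  have h2 : e ^ (-(1 / N)) = (N + 1) ^ (1 / N) * ((1 - e ^ 2) ^ (1 / N))⁻¹ := by
    conv_lhs => rw [h1]
    rw [rpow_neg (by positivity), div_rpow hw.le (by positivity), inv_div, div_eq_mul_inv]
  have h3 : 1 - e = (N + e ^ 2) / (N + 1) := by field_simp; linarith
  rw [fixedValue, h2, h3, bstar, rpow_add (by positivity), rpow_one]
  have h4 : (N + 1) * (N + 1) ^ (1 / N) / N * (1 + e ^ 4 / ((1 - e ^ 2) * (N + e ^ 2))) =
    (N + 1) ^ (1 / N) * (1 + 1 / N * ((1 - e ^ 2)⁻¹ - 1)) / ((N + e ^ 2) / (N + 1)) := by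
    field_simp; ring
  rw [h4]
  gcongr

theorem bstar_le_of_two_le {n : ℕ} (hn : 2 ≤ n) : bstar n ≤ 7 / 4 * (1 + 1 / (n : ℝ)) := by
  have hn0 : (0 : ℝ) < n := by positivity
  have h1 : ((n : ℝ) + 1) ≤ (7 / 4) ^ n := by
    induction n, hn using Nat.le_induction with
    | base => norm_num
    | succ k hk ih =>
      have hk0 : (2 : ℝ) ≤ k := by exact_mod_cast hk
      have := ih (by linarith)
      rw [pow_succ]
      push_cast
      nlinarith
  have h2 : ((n : ℝ) + 1) ^ (1 / (n : ℝ)) ≤ 7 / 4 := by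
    calc ((n : ℝ) + 1) ^ (1 / (n : ℝ)) ≤ ((7 / 4) ^ n) ^ (1 / (n : ℝ)) := by gcongr
      _ = 7 / 4 := by
        rw [one_div]
        exact pow_rpow_inv_natCast (by norm_num) (by omega)
  rw [bstar, rpow_add (by positivity), rpow_one]
  have h3 : (n + 1 : ℝ) * (n + 1 : ℝ) ^ (1 / (n : ℝ)) / n =
    (n + 1 : ℝ) ^ (1 / (n : ℝ)) * (1 + 1 / (n : ℝ)) := by
    field_simp
  rw [h3]
  gcongr

theorem exists_threshold {n : ℕ} (hn : 0 < n) {e : ℝ} (he0 : 0 < e)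
    (he : e ^ 2 + (n + 1) * e = 1) :
    ∃ u₀ : ℝ, 0 < u₀ ∧ u₀ < 1 ∧
      (∀ u, 0 < u → u ≤ u₀ → n * fixedValue n e <
        bstar n * (n - u + u ^ 2 / (n * (n + 1) ^ 2)) + (1 + u / n)) ∧
      (∀ u, u₀ ≤ u → u ≤ n → fixedValue n e * (n - u) <
        bstar n * (n - u + u ^ 2 / (n * (n + 1) ^ 2))) := by
  have hN : (1 : ℝ) ≤ n := by exact_mod_cast hn
  have hb := fixedValue_le hN he0 he
  have hD := bstar_pos hN
  rcases (show n = 1 ∨ 2 ≤ n by omega) with rfl | hn2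
  · have hD4 : bstar ((1 : ℕ) : ℝ) = 4 := by
      norm_num [bstar]
    rw [hD4] at hb ⊢
    push_cast at *
    have hw : e ^ 2 ≤ 174 / 1000 := by nlinarith
    have hE : e ^ 4 / ((1 - e ^ 2) * (1 + e ^ 2)) ≤ 1 / 32 := by
      rw [div_le_div_iff₀ (by nlinarith) (by norm_num)]
      nlinarith [sq_nonneg e]
    refine ⟨3 / 10, by norm_num, by norm_num, fun u hu hu' => ?_, fun u hu hu' => ?_⟩
    · nlinarith
    · nlinarith
  · have hN2 : (2 : ℝ) ≤ n := by exact_mod_cast hn2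
    have hD2 := bstar_le_of_two_le hn2
    generalize bstar (n : ℝ) = D at *
    generalize fixedValue (n : ℝ) e = b at *
    generalize (n : ℝ) = N at *
    have hw : e ^ 2 * (N + 1) ^ 2 ≤ 1 := by
      have : (N + 1) * e ≤ 1 := by nlinarith
      have := pow_le_one₀ (n := 2) (by positivity) this
      nlinarith
    have hw1 : 0 < 1 - e ^ 2 := by nlinarith
    have hE : e ^ 4 / ((1 - e ^ 2) * (N + e ^ 2)) ≤ 1 / (N ^ 2 * (N + 1) ^ 2 * (N + 2)) := by
      have h1 : e ^ 2 ≤ 1 / (N + 1) ^ 2 := by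
        rw [le_div_iff₀ (by positivity)]; exact hw
      have h2 : N * (N + 2) / (N + 1) ^ 2 ≤ 1 - e ^ 2 := by
        have : N * (N + 2) / (N + 1) ^ 2 = 1 - 1 / (N + 1) ^ 2 := by field_simp; ring
        linarith
      calc e ^ 4 / ((1 - e ^ 2) * (N + e ^ 2)) = (e ^ 2) ^ 2 / ((1 - e ^ 2) * (N + e ^ 2)) := by
            ring
        _ ≤ (1 / (N + 1) ^ 2) ^ 2 / ((N * (N + 2) / (N + 1) ^ 2) * N) := by
            gcongr
            nlinarith
        _ = _ := by field_simp
    have hb1 : b ≤ D * (1 + 1 / (N ^ 2 * (N + 1) ^ 2 * (N + 2))) := hb.trans (by gcongr)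
    refine ⟨45 / 100, by norm_num, by norm_num, fun u hu hu' => ?_, fun u hu hu' => ?_⟩
    · have hs : 1 / N ≤ 1 / 2 := by gcongr
      have hD3 : D * (1 / 72) ≤ 105 / 2880 := by linarith
      have h1 : N * b ≤ D * N + D * (1 / 72) := by
        calc N * b ≤ N * (D * (1 + 1 / (N ^ 2 * (N + 1) ^ 2 * (N + 2)))) := by gcongr
          _ = D * N + D * (1 / (N * (N + 1) ^ 2 * (N + 2))) := by field_simp
          _ ≤ D * N + D * (1 / (2 * (2 + 1) ^ 2 * (2 + 2))) := by gcongr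
          _ = _ := by norm_num
      have h2 : 0 ≤ D * (u ^ 2 / (N * (N + 1) ^ 2)) := by positivity
      have h3 : u * (D - 1 / N) ≤ 45 / 100 * (17 / 8) :=
        calc u * (D - 1 / N) ≤ u * (17 / 8) := by gcongr; linarith
          _ ≤ _ := by gcongr
      have h4 : u / N = u * (1 / N) := by ring
      rw [h4]
      nlinarith
    · have h1 : 1 / (N ^ 2 * (N + 1) ^ 2 * (N + 2)) * (N - u) < u ^ 2 / (N * (N + 1) ^ 2) := by
        have h5 : N - u < u ^ 2 * (N * (N + 2)) := by
          have : (45 / 100) ^ 2 * (N * (N + 2)) ≤ u ^ 2 * (N * (N + 2)) := by gcongr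
          nlinarith [sq_nonneg (N - 3 / 2)]
        have h6 : u ^ 2 / (N * (N + 1) ^ 2) =
            1 / (N ^ 2 * (N + 1) ^ 2 * (N + 2)) * (u ^ 2 * (N * (N + 2))) := by
          field_simp
        rw [h6]
        gcongr
      calc b * (N - u) ≤ D * (1 + 1 / (N ^ 2 * (N + 1) ^ 2 * (N + 2))) * (N - u) := by
            gcongr
        _ = D * (N - u + 1 / (N ^ 2 * (N + 1) ^ 2 * (N + 2)) * (N - u)) := by ring
        _ < _ := by gcongr

theorem gaussMap_eq_fract (x : ℝ) : gaussMap x = Int.fract (1 / x) := rfl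

theorem Irrational.gaussMap {x : ℝ} (hx : Irrational x) : Irrational (gaussMap x) := by
  rw [_root_.gaussMap, one_div]
  exact hx.inv.sub_intCast _

theorem gaussMap_mem_Ioo {x : ℝ} (hx : Irrational x) : gaussMap x ∈ Ioo (0 : ℝ) 1 := by
  refine ⟨lt_of_le_of_ne (Int.fract_nonneg _) ?_, Int.fract_lt_one _⟩
  exact hx.gaussMap.ne_zero.symm

theorem gaussMap_eq_sub {x : ℝ} {k : ℕ} (h : (k : ℝ) ≤ 1 / x) (h' : 1 / x < k + 1) :
    gaussMap x = 1 / x - k := by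
  have : ⌊1 / x⌋ = (k : ℤ) := Int.floor_eq_iff.2 ⟨by exact_mod_cast h, by exact_mod_cast h'⟩
  rw [gaussMap, this, Int.cast_natCast]

theorem eta_pos (m : ℕ) : 0 < eta m := by
  have : (m : ℝ) < √((m : ℝ) ^ 2 + 4) := lt_sqrt_of_sq_lt (by linarith)
  unfold eta
  linarith

theorem eta_sq_add (m : ℕ) : eta m ^ 2 + m * eta m = 1 := by
  have := sq_sqrt (show (0 : ℝ) ≤ (m : ℝ) ^ 2 + 4 by positivity)
  unfold eta
  linarith

theorem eta_lt_one {m : ℕ} (hm : 0 < m) : eta m < 1 := by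
  have h1 : (1 : ℝ) ≤ m := by exact_mod_cast hm
  nlinarith [eta_pos m, eta_sq_add m]

theorem one_div_eta (m : ℕ) : 1 / eta m = m + eta m := by
  have := eta_pos m
  have := eta_sq_add m
  field_simp
  linarith

theorem gaussMap_eta {m : ℕ} (hm : 0 < m) : gaussMap (eta m) = eta m := by
  have h := one_div_eta m
  rw [gaussMap_eq_sub (k := m) (by linarith [eta_pos m]) (by linarith [eta_lt_one hm]), h]
  ring

/-- The lower bound for the Brjuno function obtained by bounding its tail below by
`fixedValue N e`. -/
noncomputable def tailBound (N e x : ℝ) : ℝ := x ^ (-(1 / N)) + fixedValue N e * x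

theorem fixedValue_pos {N e : ℝ} (he0 : 0 < e) (he1 : e < 1) : 0 < fixedValue N e :=
  div_pos (rpow_pos_of_pos he0 _) (by linarith)

theorem tailBound_self {N e : ℝ} (he1 : e < 1) : tailBound N e e = fixedValue N e := by
  have : 1 - e ≠ 0 := by linarith
  rw [tailBound, fixedValue]
  field_simp
  ring

theorem tangent_le_tailBound {N e x : ℝ} (hN : 1 ≤ N) (he0 : 0 < e) (he1 : e < 1) (hx : 0 < x) :
    fixedValue N e + fixedValue N e * ((1 - e) / (N * e) - 1) * (e - x) ≤ tailBound N e x := by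
  have hN0 : 0 < N := by linarith
  have h1 := one_add_mul_one_sub_le_rpow_neg (div_pos hx he0) (by positivity : 0 ≤ 1 / N)
    (by rw [div_le_one hN0]; exact hN)
  have hP : e ^ (-(1 / N)) = fixedValue N e * (1 - e) := by
    have : 1 - e ≠ 0 := by linarith
    rw [fixedValue]
    field_simp
  have hx' : x ^ (-(1 / N)) = fixedValue N e * (1 - e) * (x / e) ^ (-(1 / N)) := by
    rw [← hP, ← mul_rpow he0.le (by positivity)]
    congr 1
    field_simp
  have hb := fixedValue_pos (N := N) he0 he1
  rw [tailBound, hx']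
  have he1' : 0 < 1 - e := by linarith
  calc _ = fixedValue N e * (1 - e) * (1 + 1 / N * (1 - x / e)) + fixedValue N e * x := by
        field_simp
        ring
    _ ≤ _ := by gcongr

theorem lt_rpow_add_mul_max {n : ℕ} (hn : 0 < n) {x : ℝ} (hx : Irrational x)
    (hx01 : x ∈ Ioo (0 : ℝ) 1) (hne : x ≠ eta (n + 1)) :
    fixedValue n (eta (n + 1)) < x ^ (-(1 / (n : ℝ))) +
      x * max (fixedValue n (eta (n + 1))) (tailBound n (eta (n + 1)) (gaussMap x)) := by
  obtain ⟨hx0, hx1⟩ := hx01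
  have hN : (1 : ℝ) ≤ n := by exact_mod_cast hn
  have he0 := eta_pos (n + 1)
  have he1 := eta_lt_one n.succ_pos
  have he := eta_sq_add (n + 1)
  have hinv := one_div_eta (n + 1)
  obtain ⟨hy0, hy1⟩ := gaussMap_mem_Ioo hx
  have hT := tangent_le_tailBound hN he0 he1 hx0
  have hT' := tangent_le_tailBound hN he0 he1 hy0
  have hb := fixedValue_pos (N := n) he0 he1
  have hmul1 := mul_le_mul_of_nonneg_left (le_max_left (fixedValue n (eta (n + 1)))
    (tailBound n (eta (n + 1)) (gaussMap x))) hx0.le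
  have hmul2 := mul_le_mul_of_nonneg_left (le_max_right (fixedValue n (eta (n + 1)))
    (tailBound n (eta (n + 1)) (gaussMap x))) hx0.le
  push_cast at he hinv
  obtain ⟨u₀, hu0, hu1, hnear, hfar⟩ := exists_threshold hn he0 he
  have hc : 0 < (1 - eta (n + 1)) / (n * eta (n + 1)) - 1 := by
    rw [sub_pos, lt_div_iff₀ (by positivity)]
    nlinarith
  have hκ := mul_pos hb hc
  generalize fixedValue n (eta (n + 1)) * ((1 - eta (n + 1)) / (n * eta (n + 1)) - 1) = κ at *
  have hpow : (1 / x) ^ (1 + 1 / (n : ℝ)) * x = x ^ (-(1 / (n : ℝ))) := by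
    rw [rpow_add (by positivity), rpow_one, rpow_neg hx0.le, one_div x, inv_rpow hx0.le]
    field_simp
  rcases lt_or_gt_of_ne hne with hlt | hgt
  · have := mul_pos hκ (sub_pos.2 hlt)
    rw [tailBound] at hT
    linarith
  have hxinv : 1 / x < n + 1 + eta (n + 1) := by
    rw [← hinv]
    exact one_div_lt_one_div_of_lt he0 hgt
  have hxinv1 : 1 < 1 / x := by rwa [one_lt_div hx0]
  have hxx : 1 / x * x = 1 := by field_simp
  rcases le_or_gt (n + 1 : ℝ) (1 / x) with h1 | h1
  · have hg := gaussMap_eq_sub (x := x) (k := n + 1) (by exact_mod_cast h1)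
      (by push_cast; linarith)
    push_cast at hg
    have h2 := mul_le_mul_of_nonneg_left hT' hx0.le
    have h3 : x * (eta (n + 1) - gaussMap x) = (x - eta (n + 1)) / eta (n + 1) := by
      rw [hg, sub_div, div_self he0.ne', div_eq_mul_one_div x, hinv]
      linarith
    have h4 : x - eta (n + 1) < (x - eta (n + 1)) / eta (n + 1) := by
      rw [lt_div_iff₀ he0]
      nlinarith
    have h5 := mul_lt_mul_of_pos_left h4 hκ
    rw [← h3] at h5
    rw [tailBound] at hT
    linarith
  have hL := bstar_mul_le_rpow (u := n + 1 - 1 / x) hN (by linarith) (by linarith)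
  rw [sub_sub_cancel] at hL
  rcases le_or_gt u₀ (n + 1 - 1 / x) with h2 | h2
  · have h3 := mul_lt_mul_of_pos_right ((hfar _ h2 (by linarith)).trans_le hL) hx0
    rw [hpow] at h3
    have h4 : fixedValue n (eta (n + 1)) * (n - (n + 1 - 1 / x)) * x =
      fixedValue n (eta (n + 1)) * (1 / x * x - x) := by ring
    rw [h4, hxx] at h3
    linarith
  · have hg := gaussMap_eq_sub (x := x) (k := n) (by linarith) h1
    have h3 := hnear _ (by linarith) h2.le
    have h4 := one_add_mul_one_sub_le_rpow_neg hy0 (by positivity : 0 ≤ 1 / (n : ℝ))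
      (by rw [div_le_one (by positivity)]; exact hN)
    have h5 : (n + 1 - 1 / x) / n = 1 / (n : ℝ) * (1 - gaussMap x) := by rw [hg]; ring
    rw [h5] at h3
    have h6 : n * fixedValue n (eta (n + 1)) <
        (1 / x) ^ (1 + 1 / (n : ℝ)) + gaussMap x ^ (-(1 / (n : ℝ))) := by linarith
    have h7 := mul_lt_mul_of_pos_right h6 hx0
    rw [add_mul, hpow] at h7
    have h8 : gaussMap x * x = 1 - n * x := by rw [hg, sub_mul, hxx]
    have h9 : x * tailBound n (eta (n + 1)) (gaussMap x) = gaussMap x ^ (-(1 / (n : ℝ))) * x +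
        fixedValue n (eta (n + 1)) * (gaussMap x * x) := by
      rw [tailBound]
      ring
    rw [h9, h8] at hmul2
    linarith

theorem brjunoBeta_zero (x : ℝ) : brjunoBeta x 0 = 1 := by simp [brjunoBeta]

theorem brjunoBeta_succ (x : ℝ) (j : ℕ) :
    brjunoBeta x (j + 1) = x * brjunoBeta (gaussMap x) j := by
  rw [brjunoBeta, Finset.prod_range_succ', mul_comm]
  rfl

theorem brjuno_eq_add_mul {σ x : ℝ} (hx : 0 ≤ x) :
    brjuno σ x = ENNReal.ofReal (x ^ (-(1 / σ))) + ENNReal.ofReal x * brjuno σ (gaussMap x) := by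
  rw [brjuno, tsum_eq_zero_add' ENNReal.summable, brjuno, ← ENNReal.tsum_mul_left]
  congr 1
  · simp [brjunoBeta_zero]
  · refine tsum_congr fun j => ?_
    rw [← ENNReal.ofReal_mul hx, brjunoBeta_succ, Function.iterate_succ_apply, mul_assoc]

theorem brjuno_of_isFixedPt {σ e : ℝ} (h : gaussMap e = e) (he0 : 0 < e) (he1 : e < 1) :
    brjuno σ e = ENNReal.ofReal (fixedValue σ e) := by
  have h1 : ∀ j, gaussMap^[j] e = e := Function.iterate_fixed h
  have h2 : ∀ j, brjunoBeta e j = e ^ j := fun j => by simp [brjunoBeta, h1]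
  simp only [brjuno, h1, h2]
  have hs := (hasSum_geometric_of_lt_one he0.le he1).mul_right (e ^ (-(1 / σ)))
  rw [← ENNReal.ofReal_tsum_of_nonneg (fun j => by positivity) hs.summable, hs.tsum_eq,
    fixedValue, inv_mul_eq_div]

theorem iterate_gaussMap_mem {x : ℝ} (hx : Irrational x) (hx01 : x ∈ Ioo (0 : ℝ) 1) (j : ℕ) :
    Irrational (gaussMap^[j] x) ∧ gaussMap^[j] x ∈ Ioo (0 : ℝ) 1 := by
  induction j with
  | zero => exact ⟨hx, hx01⟩
  | succ j ih =>
    rw [Function.iterate_succ_apply']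
    exact ⟨ih.1.gaussMap, gaussMap_mem_Ioo ih.1⟩

theorem brjunoBeta_nonneg {x : ℝ} (hx : Irrational x) (hx01 : x ∈ Ioo (0 : ℝ) 1) (j : ℕ) :
    0 ≤ brjunoBeta x j :=
  Finset.prod_nonneg fun i _ => (iterate_gaussMap_mem hx hx01 i).2.1.le

theorem tendsto_brjunoBeta_of_brjuno_ne_top {σ x : ℝ} (hσ : 0 ≤ σ) (hx : Irrational x)
    (hx01 : x ∈ Ioo (0 : ℝ) 1) (h : brjuno σ x ≠ ∞) :
    Filter.Tendsto (fun j => ENNReal.ofReal (brjunoBeta x j)) Filter.atTop (nhds 0) := by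
  refine tendsto_of_tendsto_of_tendsto_of_le_of_le tendsto_const_nhds
    (ENNReal.tendsto_atTop_zero_of_tsum_ne_top h) (fun _ => zero_le) fun j => ?_
  obtain ⟨h0, h1⟩ := (iterate_gaussMap_mem hx hx01 j).2
  refine ENNReal.ofReal_le_ofReal (le_mul_of_one_le_right (brjunoBeta_nonneg hx hx01 j) ?_)
  exact one_le_rpow_of_pos_of_le_one_of_nonpos h0 h1.le (by simpa using hσ)

/-- A function `V` with `V x ≤ x ^ (-1 / σ) + x * V (A x)`, bounded above by `x ^ (-1 / σ) + C`,
is a lower bound for the Brjuno function. -/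
theorem ofReal_le_brjuno_of_le {σ C : ℝ} (hσ : 0 ≤ σ) (hC : 0 ≤ C) {V : ℝ → ℝ}
    (hV : ∀ x, Irrational x → x ∈ Ioo (0 : ℝ) 1 → V x ≤ x ^ (-(1 / σ)) + x * V (gaussMap x))
    (hVC : ∀ x, Irrational x → x ∈ Ioo (0 : ℝ) 1 → V x ≤ x ^ (-(1 / σ)) + C)
    {x : ℝ} (hx : Irrational x) (hx01 : x ∈ Ioo (0 : ℝ) 1) :
    ENNReal.ofReal (V x) ≤ brjuno σ x := by
  have key : ∀ K : ℕ, ∀ x, Irrational x → x ∈ Ioo (0 : ℝ) 1 →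
      ENNReal.ofReal (V x) ≤ brjuno σ x + ENNReal.ofReal C * ENNReal.ofReal (brjunoBeta x K) := by
    intro K
    induction K with
    | zero =>
      intro x hx hx01
      rw [brjuno_eq_add_mul hx01.1.le, brjunoBeta_zero, ENNReal.ofReal_one, mul_one]
      calc ENNReal.ofReal (V x) ≤ ENNReal.ofReal (x ^ (-(1 / σ)) + C) :=
            ENNReal.ofReal_le_ofReal (hVC x hx hx01)
        _ = ENNReal.ofReal (x ^ (-(1 / σ))) + ENNReal.ofReal C :=
            ENNReal.ofReal_add (rpow_nonneg hx01.1.le _) hC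
        _ ≤ _ := by
            gcongr
            exact le_self_add
    | succ K ih =>
      intro x hx hx01
      have hy := ih _ hx.gaussMap (gaussMap_mem_Ioo hx)
      calc ENNReal.ofReal (V x) ≤ ENNReal.ofReal (x ^ (-(1 / σ)) + x * V (gaussMap x)) :=
            ENNReal.ofReal_le_ofReal (hV x hx hx01)
        _ ≤ ENNReal.ofReal (x ^ (-(1 / σ))) + ENNReal.ofReal (x * V (gaussMap x)) :=
            ENNReal.ofReal_add_le
        _ ≤ ENNReal.ofReal (x ^ (-(1 / σ))) + ENNReal.ofReal x * (brjuno σ (gaussMap x) +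
              ENNReal.ofReal C * ENNReal.ofReal (brjunoBeta (gaussMap x) K)) := by
            rw [ENNReal.ofReal_mul hx01.1.le]
            gcongr
        _ = _ := by
            rw [brjuno_eq_add_mul hx01.1.le, brjunoBeta_succ, ENNReal.ofReal_mul hx01.1.le]
            ring
  rcases eq_or_ne (brjuno σ x) ∞ with h | h
  · simp [h]
  · have ht := (ENNReal.Tendsto.const_mul (a := ENNReal.ofReal C)
      (tendsto_brjunoBeta_of_brjuno_ne_top hσ hx hx01 h)
      (Or.inr ENNReal.ofReal_ne_top)).const_add (brjuno σ x)
    rw [mul_zero, add_zero] at ht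
    exact ge_of_tendsto' ht fun K => key K x hx hx01

theorem max_le_brjuno {n : ℕ} (hn : 0 < n) {x : ℝ} (hx : Irrational x)
    (hx01 : x ∈ Ioo (0 : ℝ) 1) :
    ENNReal.ofReal (max (fixedValue n (eta (n + 1))) (tailBound n (eta (n + 1)) x)) ≤
      brjuno n x := by
  have he1 := eta_lt_one n.succ_pos
  have hb := fixedValue_pos (N := n) (eta_pos (n + 1)) he1
  refine ofReal_le_brjuno_of_le (σ := n)
    (V := fun x => max (fixedValue n (eta (n + 1))) (tailBound n (eta (n + 1)) x))
    (Nat.cast_nonneg n) hb.le (fun x hx hx01 => ?_) (fun x hx hx01 => ?_) hx hx01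
  · have h1 := mul_le_mul_of_nonneg_left (le_max_left (fixedValue n (eta (n + 1)))
      (tailBound n (eta (n + 1)) (gaussMap x))) hx01.1.le
    have h2 : tailBound n (eta (n + 1)) x ≤ x ^ (-(1 / (n : ℝ))) +
        x * max (fixedValue n (eta (n + 1))) (tailBound n (eta (n + 1)) (gaussMap x)) := by
      rw [tailBound]
      linarith
    refine max_le ?_ h2
    rcases eq_or_ne x (eta (n + 1)) with h | h
    · exact (tailBound_self (N := n) he1).symm.le.trans (h ▸ h2)
    · exact (lt_rpow_add_mul_max hn hx hx01 h).le
  · have h1 := rpow_nonneg hx01.1.le (-(1 / (n : ℝ)))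
    have h2 := mul_le_of_le_one_right hb.le hx01.2.le
    refine max_le (by linarith) ?_
    rw [tailBound]
    linarith

theorem lt_brjuno_of_ne_eta {n : ℕ} (hn : 0 < n) {x : ℝ} (hx : Irrational x)
    (hx01 : x ∈ Ioo (0 : ℝ) 1) (hne : x ≠ eta (n + 1)) :
    ENNReal.ofReal (fixedValue n (eta (n + 1))) < brjuno n x := by
  have h := lt_rpow_add_mul_max hn hx hx01 hne
  have hb := fixedValue_pos (N := n) (eta_pos (n + 1)) (eta_lt_one n.succ_pos)
  rw [brjuno_eq_add_mul hx01.1.le]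
  refine ((ENNReal.ofReal_lt_ofReal_iff (hb.trans h)).2 h).trans_le ?_
  refine ENNReal.ofReal_add_le.trans ?_
  rw [ENNReal.ofReal_mul hx01.1.le]
  gcongr
  exact max_le_brjuno hn hx.gaussMap (gaussMap_mem_Ioo hx)

/-- for `σ = n ∈ ℕ`, `B_n` attains its unique global minimum on the
irrationals of `(0,1)` at `η_{n+1}`. -/
theorem brjuno_nat_global_min (n : ℕ) (hn : 0 < n) (x : ℝ) (hx : Irrational x)
    (hx01 : x ∈ Set.Ioo (0 : ℝ) 1) :
    brjuno n (eta (n + 1)) ≤ brjuno n x ∧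
      (brjuno n x = brjuno n (eta (n + 1)) ↔ x = eta (n + 1)) := by
  rcases eq_or_ne x (eta (n + 1)) with rfl | hne
  · exact ⟨le_rfl, by simp⟩
  · have h := lt_brjuno_of_ne_eta hn hx hx01 hne
    rw [brjuno_of_isFixedPt (gaussMap_eta n.succ_pos) (eta_pos _) (eta_lt_one n.succ_pos)]
    exact ⟨h.le, iff_of_false h.ne' hne⟩
end

section
/- Let σ > 0, b* = (σ+1)^{1+1/σ}/σ, g(x) = x^{−1/σ} + b*·x, and for a positive integer k let g_k(x) = x^{−1/σ} + x·(1/x − k)^{−1/σ} + (1 − k x)·b*. Then g_k(x) ≥ g(x) for every x ∈ (1/(k+1), 1/k); moreover g_k − g is convex on (1/(k+1), 1/k) and vanishes to first order at the point p = 1/(k + 1/(σ+1)), i.e. g_k(p) = g(p) and g_k'(p) = g'(p). -/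
open Real Set MeasureTheory
open scoped ENNReal

/-- `t ^ (-s)` lies above its tangent line at `1`. -/
theorem one_sub_mul_sub_one_le_rpow_neg {s t : ℝ} (hs : 0 ≤ s) (ht : 0 < t) :
    1 - s * (t - 1) ≤ t ^ (-s) := by
  rw [Real.rpow_def_of_pos ht]
  have h₁ := Real.add_one_le_exp (Real.log t * -s)
  have h₂ := mul_le_mul_of_nonneg_left (Real.log_le_sub_one_of_pos ht) hs
  linarith

/-- `u ^ (-s)` lies above its tangent line at any positive point `c`. -/
theorem tangent_le_rpow_neg {s u c : ℝ} (hs : 0 ≤ s) (hu : 0 < u) (hc : 0 < c) :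
    c ^ (-s) * (1 - s * (u / c - 1)) ≤ u ^ (-s) := by
  have h := mul_le_mul_of_nonneg_left
    (one_sub_mul_sub_one_le_rpow_neg hs (div_pos hu hc)) (Real.rpow_nonneg hc.le (-s))
  rwa [← Real.mul_rpow hc.le (div_pos hu hc).le, mul_div_cancel₀ u hc.ne'] at h

/-- A power with nonpositive exponent is convex on the positive half-line. -/
theorem convexOn_rpow_neg_Ioi {s : ℝ} (hs : 0 ≤ s) :
    ConvexOn ℝ (Ioi 0) fun u : ℝ => u ^ (-s) := by
  refine ⟨convex_Ioi 0, fun x hx y hy a b ha hb hab => ?_⟩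
  have hc : 0 < a • x + b • y := convex_Ioi (0 : ℝ) hx hy ha hb hab
  have h₁ := mul_le_mul_of_nonneg_left (tangent_le_rpow_neg hs hx hc) ha
  have h₂ := mul_le_mul_of_nonneg_left (tangent_le_rpow_neg hs hy hc) hb
  simp only [smul_eq_mul] at hc h₁ h₂ ⊢
  refine le_trans (le_of_eq ?_) (add_le_add h₁ h₂)
  have key : a * (x / (a * x + b * y)) + b * (y / (a * x + b * y)) = 1 := by
    field_simp
  linear_combination (-(a * x + b * y) ^ (-s) * (1 + s)) * hab +
    (a * x + b * y) ^ (-s) * s * key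

/-- If `h` is convex on the positive half-line, so is `x ↦ x * h (1 / x - k)` where
`1 / x - k` is positive. -/
theorem ConvexOn.mul_comp_inv_sub {h : ℝ → ℝ} (hh : ConvexOn ℝ (Ioi 0) h) {S : Set ℝ}
    (hS : Convex ℝ S) {k : ℝ} (hpos : ∀ x ∈ S, 0 < x) (hsub : ∀ x ∈ S, 0 < 1 / x - k) :
    ConvexOn ℝ S fun x => x * h (1 / x - k) := by
  refine ⟨hS, fun x hx y hy a b ha hb hab => ?_⟩
  have hz := hpos _ (hS hx hy ha hb hab)
  have hx₀ := hpos x hx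
  have hy₀ := hpos y hy
  simp only [smul_eq_mul] at hz ⊢
  set z := a * x + b * y with hzdef
  have hw : a * x / z + b * y / z = 1 := by rw [← add_div, div_self hz.ne']
  have hconv := hh.2 (hsub x hx) (hsub y hy) (by positivity : 0 ≤ a * x / z)
    (by positivity : 0 ≤ b * y / z) hw
  have hpt : a * x / z * (1 / x - k) + b * y / z * (1 / y - k) = 1 / z - k := by
    have e₁ : a * x / z * (1 / x) = a / z := by field_simp
    have e₂ : b * y / z * (1 / y) = b / z := by field_simp
    have e₃ : a / z + b / z = 1 / z := by rw [← add_div, hab]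
    linear_combination e₁ + e₂ + e₃ - k * hw
  simp only [smul_eq_mul] at hconv
  rw [hpt] at hconv
  calc z * h (1 / z - k)
      ≤ z * (a * x / z * h (1 / x - k) + b * y / z * h (1 / y - k)) :=
        mul_le_mul_of_nonneg_left hconv hz.le
    _ = a * (x * h (1 / x - k)) + b * (y * h (1 / y - k)) := by field_simp

theorem bstar_eq {σ : ℝ} (hσ : 0 < σ) :
    bstar σ = (1 / (σ + 1)) ^ (-(1 / σ)) * ((σ + 1) / σ) := by
  have h : 0 < σ + 1 := by linarith
  rw [bstar, one_div (σ + 1), Real.inv_rpow h.le, Real.rpow_neg h.le, inv_inv,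
    Real.rpow_add h, Real.rpow_one]
  ring

theorem gCyl_sub_gLow (σ : ℝ) (k : ℕ) {x : ℝ} (hx : x ≠ 0) :
    gCyl σ k x - gLow σ x =
      x * ((1 / x - k) ^ (-(1 / σ)) + bstar σ * ((1 / x - k) - 1)) := by
  have h : x * (1 / x) = 1 := mul_one_div_cancel hx
  rw [gCyl, gLow]
  linear_combination -(bstar σ) * h

theorem rpow_neg_add_bstar_nonneg {σ u : ℝ} (hσ : 0 < σ) (hu : 0 < u) :
    0 ≤ u ^ (-(1 / σ)) + bstar σ * (u - 1) := by
  have hc : 0 < 1 / (σ + 1) := by positivity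
  have h := tangent_le_rpow_neg (one_div_pos.2 hσ).le hu hc
  refine (le_of_eq ?_).trans (add_le_add_left h _)
  rw [bstar_eq hσ]
  field_simp
  ring

theorem rpow_neg_add_bstar_eq_zero {σ : ℝ} (hσ : 0 < σ) :
    (1 / (σ + 1)) ^ (-(1 / σ)) + bstar σ * (1 / (σ + 1) - 1) = 0 := by
  rw [bstar_eq hσ]
  field_simp
  ring

/-- `g_k ≥ g` on the cylinder `(1/(k+1), 1/k)`; moreover `g_k − g` is
convex there and vanishes to first order at `p = 1/(k + 1/(σ+1))`. -/
theorem gCyl_ge_gLow (σ : ℝ) (hσ : 0 < σ) (k : ℕ) (hk : 0 < k) :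
    (∀ x ∈ Set.Ioo (1 / ((k : ℝ) + 1)) (1 / (k : ℝ)), gLow σ x ≤ gCyl σ k x) ∧
    ConvexOn ℝ (Set.Ioo (1 / ((k : ℝ) + 1)) (1 / (k : ℝ)))
      (fun x => gCyl σ k x - gLow σ x) ∧
    gCyl σ k (1 / ((k : ℝ) + 1 / (σ + 1))) = gLow σ (1 / ((k : ℝ) + 1 / (σ + 1))) ∧
    deriv (gCyl σ k) (1 / ((k : ℝ) + 1 / (σ + 1))) =
      deriv (gLow σ) (1 / ((k : ℝ) + 1 / (σ + 1))) := by
  have hk' : (0 : ℝ) < k := Nat.cast_pos.2 hk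
  set I := Set.Ioo (1 / ((k : ℝ) + 1)) (1 / (k : ℝ))
  have hpos : ∀ x ∈ I, 0 < x := fun x hx => lt_trans (by positivity) hx.1
  have hsub : ∀ x ∈ I, 0 < 1 / x - (k : ℝ) := fun x hx =>
    sub_pos.2 ((lt_one_div (hpos x hx) hk').1 hx.2)
  have hle : ∀ x ∈ I, gLow σ x ≤ gCyl σ k x := fun x hx => by
    rw [← sub_nonneg, gCyl_sub_gLow σ k (hpos x hx).ne']
    exact mul_nonneg (hpos x hx).le (rpow_neg_add_bstar_nonneg hσ (hsub x hx))
  have hc : 0 < 1 / (σ + 1) := by positivity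
  set p := 1 / ((k : ℝ) + 1 / (σ + 1)) with hp
  have hp₀ : 0 < p := by positivity
  have hpI : p ∈ I := by
    constructor
    · refine one_div_lt_one_div_of_lt (by positivity) (add_lt_add_right ?_ _)
      rw [div_lt_one] <;> linarith
    · exact one_div_lt_one_div_of_lt hk' (by linarith)
  have hpeq : gCyl σ k p - gLow σ p = 0 := by
    rw [gCyl_sub_gLow σ k hp₀.ne', show 1 / p - (k : ℝ) = 1 / (σ + 1) by rw [hp]; simp,
      rpow_neg_add_bstar_eq_zero hσ, mul_zero]
  refine ⟨hle, ?_, sub_eq_zero.1 hpeq, ?_⟩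
  · have hh : ConvexOn ℝ (Ioi 0) fun u : ℝ => u ^ (-(1 / σ)) + bstar σ * (u - 1) := by
      refine (convexOn_rpow_neg_Ioi (one_div_pos.2 hσ).le).add
        ⟨convex_Ioi 0, fun x _ y _ a b _ _ hab => le_of_eq ?_⟩
      simp only [smul_eq_mul]
      linear_combination bstar σ * hab
    exact (hh.mul_comp_inv_sub (convex_Ioo _ _) hpos hsub).congr fun x hx =>
      (gCyl_sub_gLow σ k (hpos x hx).ne').symm
  · have hpow : DifferentiableAt ℝ (fun x : ℝ => x ^ (-(1 / σ))) p :=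
      differentiableAt_id.rpow_const (Or.inl hp₀.ne')
    have hlow : DifferentiableAt ℝ (gLow σ) p :=
      hpow.add (differentiableAt_id.const_mul _)
    have hinv : DifferentiableAt ℝ (fun x : ℝ => 1 / x - (k : ℝ)) p := by
      fun_prop (disch := exact hp₀.ne')
    have hcyl : DifferentiableAt ℝ (gCyl σ k) p :=
      (hpow.add (differentiableAt_id.mul (hinv.rpow_const (Or.inl (hsub p hpI).ne')))).add
        (((differentiableAt_id.const_mul _).const_sub _).mul_const _)
    have hmin : IsLocalMin (gCyl σ k - gLow σ) p := by
      filter_upwards [Ioo_mem_nhds hpI.1 hpI.2] with x hx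
      simpa [hpeq] using hle x hx
    rw [← sub_eq_zero, ← deriv_sub hcyl hlow]
    exact hmin.deriv_eq_zero
end
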